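/- Let (R, m, k) be an F-finite Noetherian local ring of prime characteristic p. If R^{1/q} is a free R-module for some q = p^e with q > 1, then R is regular. -/

import Mathlib

open IsLocalRing

/-- `Frob R p e` is `R^{1/q}` for `q = p^e`: the abelian group `R` viewed as an `R`-module
via the `e`-th iterate of the Frobenius endomorphism, `r • x = r^(p^e) * x`. -/
def Frob (R : Type*) [CommRing R] (p e : ℕ) [ExpChar R p] : Type _ := R

noncomputable instance (R : Type*) [CommRing R] (p e : ℕ) [ExpChar R p] :
    AddCommGroup (Frob R p e) := inferInstanceAs (AddCommGroup R)

noncomputable instance (R : Type*) [CommRing R] (p e : ℕ) [ExpChar R p] :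
    Module R (Frob R p e) := Module.compHom R (iterateFrobenius R p e)

/-- `R` is a regular local ring: the maximal ideal is generated by `dim R` elements. -/
def IsRegularLocal (R : Type*) [CommRing R] [IsLocalRing R] : Prop :=
  ∃ s : Finset R, Ideal.span (s : Set R) = maximalIdeal R ∧
    (s.card : WithBot ℕ∞) = ringKrullDim R


namespace KunzAux

variable {R : Type*} [CommRing R] {ι : Type*} [Fintype ι] [DecidableEq ι]

/-- The colon ideal `I : g`. -/
def colonI (I : Ideal R) (g : R) : Ideal R :=
  Submodule.comap (LinearMap.mulRight R g) I

theorem mem_colonI (I : Ideal R) (g r : R) : r ∈ colonI I g ↔ r * g ∈ I := by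
  simp [colonI]

theorem colonI_le (I : Ideal R) (g : R) :
    colonI I g ≤ Submodule.comap (LinearMap.mulRight R g) I := le_rfl

theorem length_colon (I I' : Ideal R) (g : R) (hI : I' = I ⊔ Ideal.span {g}) :
    Module.length R (R ⧸ I) = Module.length R (R ⧸ colonI I g) + Module.length R (R ⧸ I') := by
  have hle : I ≤ I' := hI ▸ le_sup_left
  refine Module.length_eq_add_of_exact
    (Submodule.mapQ (colonI I g) I (LinearMap.mulRight R g) (colonI_le I g))
    (Submodule.factor hle) ?_ (Submodule.factor_surjective hle) ?_
  · rw [← LinearMap.ker_eq_bot]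
    exact Submodule.ker_liftQ_eq_bot _ _ _ (by
      intro r hr
      rw [mem_colonI]
      rw [← Ideal.Quotient.eq_zero_iff_mem, map_mul]
      simpa using hr)
  · intro y
    obtain ⟨y, rfl⟩ := Submodule.Quotient.mk_surjective _ y
    constructor
    · intro h
      have h1 : y ∈ I' := by
        rw [← Submodule.Quotient.mk_eq_zero]; exact h
      rw [hI, Submodule.mem_sup] at h1
      obtain ⟨a, ha, b, hb, rfl⟩ := h1
      obtain ⟨c, rfl⟩ := Ideal.mem_span_singleton'.1 hb
      refine ⟨Submodule.Quotient.mk c, ?_⟩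
      rw [Submodule.mapQ_apply, Submodule.Quotient.eq]
      have : LinearMap.mulRight R g c - (a + c * g) = -a := by simp
      rw [this]; exact I.neg_mem ha
    · rintro ⟨c, hc⟩
      obtain ⟨c, rfl⟩ := Submodule.Quotient.mk_surjective _ c
      rw [← hc, Submodule.mapQ_apply]
      change Submodule.Quotient.mk _ = 0
      rw [Submodule.Quotient.mk_eq_zero, hI]
      exact Ideal.mem_sup_right (Ideal.mem_span_singleton'.2 ⟨c, by simp⟩)

/-- ideal generated by a family -/
abbrev FId (f : ι → R) : Ideal R := Ideal.span (Set.range f)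

theorem mem_FId (f : ι → R) (x : R) : x ∈ FId f ↔ ∃ c : ι → R, ∑ i, c i * f i = x :=
  Ideal.mem_span_range_iff_exists_fun

/-- Lech independence -/
def Ind (f : ι → R) : Prop := ∀ c : ι → R, ∑ i, c i * f i = 0 → ∀ i, c i ∈ FId f

theorem FId_le {f f' : ι → R} (h : ∀ i, f i ∈ FId f') : FId f ≤ FId f' := by
  rw [Ideal.span_le]; rintro _ ⟨i, rfl⟩; exact h i

theorem self_mem (f : ι → R) (i : ι) : f i ∈ FId f := Ideal.subset_span ⟨i, rfl⟩

section step

variable {f f' : ι → R} {i : ι} {g h : R} (hf : f i = g * h) (hf' : f' i = g)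
  (hoff : ∀ j, j ≠ i → f' j = f j)

include hf hf' hoff

theorem le1 : FId f ≤ FId f' := by
  apply FId_le
  intro j
  by_cases hj : j = i
  · subst hj; rw [hf, ← hf']; exact Ideal.mul_mem_right _ _ (self_mem f' j)
  · rw [← hoff j hj]; exact self_mem f' j

theorem key1 (hInd : Ind f) (c : ι → R) (hc : ∑ j, c j * f' j = 0) : c i ∈ FId f := by
  have := hInd (fun j => if j = i then c i else c j * h) (by
    have : ∑ j, (if j = i then c i else c j * h) * f j = h * ∑ j, c j * f' j := by
      rw [Finset.mul_sum]
      refine Finset.sum_congr rfl fun j _ => ?_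
      by_cases hj : j = i
      · subst hj; simp [hf, hf']; ring
      · simp [hj, hoff j hj]; ring
    rw [this, hc, mul_zero]) i
  simpa using this

theorem ind1 (hInd : Ind f) : Ind f' := by
  intro c hc
  have h1 := key1 hf hf' hoff hInd c hc
  have hle := le1 hf hf' hoff
  obtain ⟨b, hb⟩ := (mem_FId _ _).1 h1
  intro j
  by_cases hj : j = i
  · subst hj; exact hle h1
  have h2 := hInd (fun j => (c j + b j * g) - if j = i then c j else 0) (by
    have e : ∀ j, ((c j + b j * g) - if j = i then c j else 0) * f j
        = c j * f' j + g * (b j * f j) - if j = i then c j * g else 0 := by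
      intro j
      by_cases hj : j = i
      · subst hj; simp [hf']; ring
      · simp [hj, hoff j hj]; ring
    simp only [e]
    rw [Finset.sum_sub_distrib, Finset.sum_add_distrib, ← Finset.mul_sum, hb, hc]
    simp; ring) j
  simp only [hj, if_false, sub_zero] at h2
  have h3 : b j * g ∈ FId f' := Ideal.mul_mem_left _ _ (hf' ▸ self_mem f' i)
  simpa using Ideal.sub_mem _ (hle h2) h3

theorem sup_eq : FId f' = FId f ⊔ Ideal.span {g} := by
  apply le_antisymm
  · rw [Ideal.span_le]
    rintro _ ⟨j, rfl⟩
    by_cases hj : j = i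
    · subst hj; rw [hf']; exact Ideal.mem_sup_right (Ideal.mem_span_singleton_self g)
    · rw [hoff j hj]; exact Ideal.mem_sup_left (self_mem f j)
  · refine sup_le (le1 hf hf' hoff) ?_
    rw [Ideal.span_le, Set.singleton_subset_iff, ← hf']
    exact self_mem f' i

variable {f'' : ι → R} (hf'' : f'' i = h) (hoff' : ∀ j, j ≠ i → f'' j = f j)

include hf'' hoff'

theorem colon_ge : FId f'' ≤ colonI (FId f) g := by
  rw [Ideal.span_le]
  rintro _ ⟨j, rfl⟩
  change _ ∈ colonI (FId f) g
  rw [mem_colonI]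
  by_cases hj : j = i
  · subst hj; rw [hf'', mul_comm, ← hf]; exact self_mem f j
  · rw [hoff' j hj]; exact Ideal.mul_mem_right _ _ (self_mem f j)

theorem colon_le (hInd : Ind f) : colonI (FId f) g ≤ FId f'' := by
  intro r hr
  rw [mem_colonI] at hr
  obtain ⟨c, hc⟩ := (mem_FId _ _).1 hr
  have hle : FId f ≤ FId f'' := le1 (g := h) (h := g) (by rw [hf, mul_comm]) hf'' hoff'
  have h1 := key1 hf hf' hoff hInd (fun j => if j = i then r - c i * h else - c j) (by
    have e : ∀ j, (if j = i then r - c i * h else - c j) * f' j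
        = (if j = i then r * g else 0) - c j * f j := by
      intro j
      by_cases hj : j = i
      · subst hj; simp [hf', hf]; ring
      · simp [hj, hoff j hj]
    simp only [e]
    rw [Finset.sum_sub_distrib, hc]; simp)
  simp only [if_true] at h1
  have h3 : c i * h ∈ FId f'' := Ideal.mul_mem_left _ _ (hf'' ▸ self_mem f'' i)
  simpa using Ideal.add_mem _ (hle h1) h3

theorem len_upper : Module.length R (R ⧸ FId f) ≤
    Module.length R (R ⧸ FId f'') + Module.length R (R ⧸ FId f') := by
  rw [length_colon (FId f) (FId f') g (sup_eq hf hf' hoff)]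
  gcongr
  exact Module.length_le_of_surjective _
    (Submodule.factor_surjective (colon_ge hf hf' hoff hf'' hoff'))

theorem len_lower (hInd : Ind f) : Module.length R (R ⧸ FId f'') + Module.length R (R ⧸ FId f') ≤
    Module.length R (R ⧸ FId f) := by
  rw [length_colon (FId f) (FId f') g (sup_eq hf hf' hoff)]
  gcongr
  exact Module.length_le_of_surjective _
    (Submodule.factor_surjective (colon_le hf hf' hoff hf'' hoff' hInd))

end step

theorem pow_ind {P : (ι → ℕ) → Prop} (h1 : P (fun _ => 1))
    (hs : ∀ a i b, 1 ≤ b → a i = b + 1 → P (Function.update a i b) → P (Function.update a i 1) →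
      P a) (a : ι → ℕ) (ha : ∀ i, 1 ≤ a i) : P a := by
  induction hn : ∑ i, a i using Nat.strong_induction_on generalizing a with
  | _ n ih =>
    by_cases hall : ∀ i, a i = 1
    · have : a = fun _ => 1 := funext hall
      rw [this]; exact h1
    push Not at hall
    obtain ⟨i, hi⟩ := hall
    have hai := ha i
    have hlt : ∀ b, b < a i → ∑ j, Function.update a i b j < n := by
      intro b hb
      rw [← hn]
      apply Finset.sum_lt_sum
      · intro j _
        by_cases hj : j = i
        · subst hj; simp; omega
        · simp [hj]
      · exact ⟨i, Finset.mem_univ _, by simpa using hb⟩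
    have hpos : ∀ b, 1 ≤ b → ∀ j, 1 ≤ Function.update a i b j := by
      intro b hb j
      by_cases hj : j = i
      · subst hj; simpa using hb
      · simpa [hj] using ha j
    refine hs a i (a i - 1) (by omega) (by omega) ?_ ?_
    · exact ih _ (hlt _ (by omega)) _ (hpos _ (by omega)) rfl
    · exact ih _ (hlt _ (by omega)) _ (hpos _ (by omega)) rfl

theorem prod_upd (a : ι → ℕ) (i : ι) (b : ℕ) (h : a i = b + 1) :
    ∏ j, a j = ∏ j, Function.update a i 1 j + ∏ j, Function.update a i b j := by
  rw [Finset.prod_update_of_mem (Finset.mem_univ i), Finset.prod_update_of_mem (Finset.mem_univ i),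
    ← Finset.mul_prod_erase Finset.univ a (Finset.mem_univ i), h, Finset.sdiff_singleton_eq_erase]
  ring

theorem upper (y : ι → R) (a : ι → ℕ) (ha : ∀ i, 1 ≤ a i) :
    Module.length R (R ⧸ FId (fun i => y i ^ a i)) ≤
      ((∏ i, a i : ℕ) : ℕ∞) * Module.length R (R ⧸ FId y) := by
  refine pow_ind (P := fun a => Module.length R (R ⧸ FId (fun i => y i ^ a i)) ≤
      ((∏ i, a i : ℕ) : ℕ∞) * Module.length R (R ⧸ FId y)) ?_ ?_ a ha
  · have e : (fun i => y i ^ 1) = y := by funext i; simp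
    rw [e]; simp
  intro a i b hb hab h1 h2
  have := len_upper (f := fun j => y j ^ a j) (f' := fun j => y j ^ Function.update a i b j)
    (f'' := fun j => y j ^ Function.update a i 1 j) (i := i) (g := y i ^ b) (h := y i)
    (by simp [hab, pow_succ]) (by simp) (by intro j hj; simp [hj]) (by simp)
    (by intro j hj; simp [hj])
  refine this.trans ?_
  rw [prod_upd a i b hab, Nat.cast_add, add_mul]
  exact add_le_add h2 h1

theorem lower [IsLocalRing R] (x : ι → R) (hx : ∀ i, x i ∈ maximalIdeal R)
    (a : ι → ℕ) (ha : ∀ i, 1 ≤ a i) (hI : Ind (fun i => x i ^ a i)) :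
    ((∏ i, a i : ℕ) : ℕ∞) ≤ Module.length R (R ⧸ FId (fun i => x i ^ a i)) := by
  refine pow_ind (P := fun a => Ind (fun i => x i ^ a i) →
    ((∏ i, a i : ℕ) : ℕ∞) ≤ Module.length R (R ⧸ FId (fun i => x i ^ a i))) ?_ ?_ a ha hI
  · intro _
    have hle : FId (fun i => x i ^ 1) ≤ maximalIdeal R := by
      rw [Ideal.span_le]; rintro _ ⟨i, rfl⟩; simpa using hx i
    have hne : FId (fun i => x i ^ 1) ≠ ⊤ := fun h =>
      (Ideal.IsPrime.ne_top' : maximalIdeal R ≠ ⊤) (top_le_iff.1 (h ▸ hle))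
    have : Nontrivial (R ⧸ FId (fun i => x i ^ 1)) := Ideal.Quotient.nontrivial_iff.2 hne
    simpa using Order.one_le_iff_pos.2 (Module.length_pos (R := R) (M := R ⧸ FId (fun i => x i ^ 1)))
  · intro a i b hb hab h1 h2 hI
    have e1 : x i ^ a i = x i ^ b * x i := by rw [hab, pow_succ]
    have e2 : x i ^ a i = x i * x i ^ b := by rw [e1, mul_comm]
    have o : ∀ c, ∀ j, j ≠ i → x j ^ Function.update a i c j = x j ^ a j := by
      intro c j hj; simp [hj]
    have i1 : Ind (fun j => x j ^ Function.update a i b j) :=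
      ind1 (f := fun j => x j ^ a j) e1 (by simp) (o b) hI
    have i2 : Ind (fun j => x j ^ Function.update a i 1 j) :=
      ind1 (f := fun j => x j ^ a j) e2 (by simp) (o 1) hI
    have := len_lower (f := fun j => x j ^ a j) (f' := fun j => x j ^ Function.update a i b j)
      (f'' := fun j => x j ^ Function.update a i 1 j) e1 (by simp) (o b) (by simp) (o 1) hI
    refine le_trans ?_ this
    rw [prod_upd a i b hab, Nat.cast_add]
    exact add_le_add (h2 i2) (h1 i1)

end KunzAux

open KunzAux

theorem KunzAux.frob_step {R : Type*} [CommRing R] (p : ℕ) [Fact p.Prime] [CharP R p]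
    (e : ℕ) (hfree : Module.Free R (Frob R p e)) {ι : Type*} [Fintype ι] [DecidableEq ι]
    (x : ι → R) (hx : Ind x) : Ind (fun i => x i ^ p ^ e) := by
  intro c hc i
  let b := Module.Free.chooseBasis R (Frob R p e)
  let c' : ι → Frob R p e := c
  have h0 : ∑ i, x i • c' i = 0 := by
    refine Eq.trans ?_ hc
    refine Finset.sum_congr rfl fun i _ => ?_
    exact mul_comm (x i ^ p ^ e) (c i)
  have hm : ∀ j, b.repr (c' i) j ∈ FId x := by
    intro j
    refine hx (fun i => b.repr (c' i) j) ?_ i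
    have := congrArg (fun z => b.repr z j) h0
    simpa [mul_comm] using this
  let I := FId (fun i => x i ^ p ^ e)
  have hpow : ∀ r ∈ FId x, r ^ p ^ e ∈ I := by
    intro r hr
    obtain ⟨d, rfl⟩ := (mem_FId _ _).1 hr
    rw [← iterateFrobenius_def, map_sum]
    refine Ideal.sum_mem _ fun j _ => ?_
    rw [iterateFrobenius_def, mul_pow]
    exact Ideal.mul_mem_left _ _ (self_mem (fun i => x i ^ p ^ e) j)
  have hrep := b.linearCombination_repr (c' i)
  rw [Finsupp.linearCombination_apply, Finsupp.sum] at hrep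
  have : c i = ∑ j ∈ (b.repr (c' i)).support, (b.repr (c' i) j) ^ p ^ e * (show R from b j) := hrep.symm
  rw [this]
  exact Ideal.sum_mem _ fun j _ => Ideal.mul_mem_right _ _ (hpow _ (hm j))

theorem KunzAux.minGen_ind {R : Type*} [CommRing R] [IsLocalRing R] (s : Finset R)
    (hs : Ideal.span (s : Set R) = maximalIdeal R)
    (hc : s.card = (maximalIdeal R).spanFinrank) : Ind (fun i : s => (i : R)) := by
  classical
  have hId : FId (fun i : s => (i : R)) = maximalIdeal R := by
    rw [← hs]; simp [FId]
  intro c h i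
  rw [hId]
  by_contra hi
  have hu : IsUnit (c i) := by simpa using hi
  obtain ⟨u, hu⟩ := hu
  let t := s.erase (i : R)
  have hmem : (i : R) ∈ Ideal.span (t : Set R) := by
    rw [← Finset.add_sum_erase Finset.univ _ (Finset.mem_univ i), ← hu] at h
    have h2 : (u : R) * i ∈ Ideal.span (t : Set R) := by
      rw [eq_neg_of_add_eq_zero_left h]
      refine Ideal.neg_mem_iff _ |>.2 <| Ideal.sum_mem _ fun j hj => ?_
      refine Ideal.mul_mem_left _ _ (Ideal.subset_span ?_)
      have hji := (Finset.mem_erase.1 hj).1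
      simp only [t, Finset.coe_erase, Set.mem_sdiff, Set.mem_singleton_iff]
      exact ⟨j.2, fun h => hji (Subtype.ext h)⟩
    simpa using Ideal.mul_mem_left _ (↑u⁻¹ : R) h2
  have ht : Ideal.span (t : Set R) = maximalIdeal R := by
    apply le_antisymm
    · rw [← hs]; exact Ideal.span_mono (by simp [t])
    · rw [← hs, Ideal.span_le]
      intro y hy
      by_cases hyi : y = i
      · rw [hyi]; exact hmem
      · exact Ideal.subset_span (by simp [t, hyi]; exact hy)
  have h1 := Submodule.spanFinrank_span_le_ncard_of_finite (R := R) (t.finite_toSet)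
  rw [Set.ncard_coe_finset] at h1
  have h3 : (Submodule.span R (t : Set R)) = maximalIdeal R := ht
  rw [h3, ← hc, Finset.card_erase_of_mem i.2] at h1
  have := Finset.card_pos.2 ⟨_, i.2⟩
  omega

theorem regular_of_frob_free
    (R : Type*) [CommRing R] [IsLocalRing R] [IsNoetherianRing R]
    (p : ℕ) [Fact p.Prime] [CharP R p]
    (hFfinite : Module.Finite R (Frob R p 1))
    (e : ℕ) (he : 0 < e) (hfree : Module.Free R (Frob R p e)) :
    IsRegularLocal R := by
  classical
  obtain ⟨s, hsc, hs⟩ := Submodule.FG.exists_span_finset_card_eq_spanFinrank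
    (IsNoetherian.noetherian (maximalIdeal R))
  have hs : Ideal.span (s : Set R) = maximalIdeal R := hs
  have hle := ringKrullDim_le_spanFinrank_maximalIdeal (R := R)
  refine ⟨s, hs, le_antisymm ?_ (hsc ▸ hle)⟩
  obtain ⟨t, ht, htc⟩ := (maximalIdeal R).exists_finset_card_eq_height_of_isNoetherianRing
  rw [← IsLocalRing.maximalIdeal_height_eq_ringKrullDim, ← htc]
  have hart := IsLocalRing.quotient_artinian_of_mem_minimalPrimes_of_isLocalRing _ ht
  let x : s → R := fun i => i
  let y : t → R := fun i => i
  have hx : FId x = maximalIdeal R := by rw [← hs]; simp [FId, x]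
  have hy : FId y = Ideal.span (t : Set R) := by simp [FId, y]
  have hlen : Module.length R (R ⧸ FId y) ≠ ⊤ := by
    rw [hy, Module.length_eq_of_surjective (S := R) (R := R ⧸ Ideal.span (t : Set R))
      Ideal.Quotient.mk_surjective]
    exact Module.length_ne_top
  obtain ⟨C, hC⟩ := ENat.ne_top_iff_exists.1 hlen
  have hind : ∀ k, Ind (fun i => x i ^ p ^ (e * k)) := by
    intro k
    induction k with
    | zero => simpa [x] using minGen_ind s hs hsc
    | succ k ih =>
      have := frob_step p e hfree _ ih
      simpa [← pow_mul, ← pow_add, mul_add] using this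
  have hp : 1 < p := (Fact.out : p.Prime).one_lt
  have hbound : ∀ k, (p ^ (e * k)) ^ s.card ≤ (p ^ (e * k)) ^ t.card * C := by
    intro k
    have hpos : 1 ≤ p ^ (e * k) := Nat.one_le_pow _ _ (by omega)
    have h1 := lower x (fun i => hx ▸ self_mem x i) (fun _ => p ^ (e * k)) (fun _ => hpos) (hind k)
    have h2 := upper y (fun _ => p ^ (e * k)) (fun _ => hpos)
    have h3 : FId (fun i => y i ^ p ^ (e * k)) ≤ FId (fun i => x i ^ p ^ (e * k)) := by
      apply Ideal.span_le.2
      rintro _ ⟨j, rfl⟩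
      have : y j ∈ FId x := by rw [hx]; exact ht.1.2 (Ideal.subset_span j.2)
      obtain ⟨d, hd⟩ := (mem_FId _ _).1 this
      change y j ^ p ^ (e * k) ∈ _
      rw [← hd, ← iterateFrobenius_def, map_sum]
      refine Ideal.sum_mem _ fun j _ => ?_
      rw [iterateFrobenius_def, mul_pow]
      exact Ideal.mul_mem_left _ _ (self_mem (fun i => x i ^ p ^ (e * k)) j)
    have h4 := Module.length_le_of_surjective _ (Submodule.factor_surjective h3)
    have h5 := h1.trans (h4.trans h2)
    rw [← hC] at h5
    simp only [Finset.prod_const, Finset.card_univ, Fintype.card_coe] at h5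
    exact_mod_cast h5
  have hfin : s.card ≤ t.card := by
    by_contra hlt
    push Not at hlt
    have h1 := hbound C
    have hpos : 0 < p ^ (e * C) := Nat.pow_pos (by omega)
    have h2 : (p ^ (e * C)) ^ (t.card + 1) ≤ (p ^ (e * C)) ^ t.card * C :=
      (Nat.pow_le_pow_right hpos hlt).trans h1
    rw [pow_succ] at h2
    have h3 := Nat.le_of_mul_le_mul_left h2 (Nat.pow_pos hpos)
    have h4 : C < p ^ C := Nat.lt_pow_self hp
    have h5 : p ^ C ≤ p ^ (e * C) :=
      Nat.pow_le_pow_right (by omega) (Nat.le_mul_of_pos_left _ he)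
    omega
  exact_mod_cast hfin
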